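/- arXiv:1701.07255 — 4 statements merged into one kernel-verified Lean document; each statement's English description precedes it below -/
import Mathlib

section
/- Let r, k, r₁', k₁', r₂', k₂' be positive integers such that r₁' ≤ r, r₂' ≤ r, and r₁'·k₁' + r₂'·k₂' ≤ r·k. Then, as rational numbers, k₁'·(r₁' − 1/r₁') + k₂'·(r₂' − 1/r₂') ≤ k·(r − 1/r). -/
theorem mul_sub_one_div_eq {s : ℚ} (hs : 0 < s) (k : ℚ) :
    k * (s - 1 / s) = s * k * (1 - 1 / s ^ 2) := by
  field_simp

theorem mul_sub_one_div_le {s r k : ℚ} (hs : 0 < s) (hk : 0 ≤ k) (hsr : s ≤ r) :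
    k * (s - 1 / s) ≤ s * k * (1 - 1 / r ^ 2) := by
  rw [mul_sub_one_div_eq hs]
  gcongr

theorem stmt_0 (r k r₁' k₁' r₂' k₂' : ℕ)
    (hr : 0 < r) (hk : 0 < k) (hr₁ : 0 < r₁') (hk₁ : 0 < k₁')
    (hr₂ : 0 < r₂') (hk₂ : 0 < k₂')
    (h₁ : r₁' ≤ r) (h₂ : r₂' ≤ r)
    (hΞ : r₁' * k₁' + r₂' * k₂' ≤ r * k) :
    (k₁' : ℚ) * ((r₁' : ℚ) - 1 / (r₁' : ℚ)) + (k₂' : ℚ) * ((r₂' : ℚ) - 1 / (r₂' : ℚ))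
      ≤ (k : ℚ) * ((r : ℚ) - 1 / (r : ℚ)) := by
  have hr_one : (1 : ℚ) ≤ r := by exact_mod_cast hr
  have hnonneg : 0 ≤ 1 - 1 / (r : ℚ) ^ 2 :=
    sub_nonneg.2 (div_le_one_of_le₀ (one_le_pow₀ hr_one) (by positivity))
  have hΞ_cast : (r₁' * k₁' + r₂' * k₂' : ℚ) ≤ r * k := by exact_mod_cast hΞ
  calc
    _ ≤ (r₁' * k₁' : ℚ) * (1 - 1 / (r : ℚ) ^ 2) + r₂' * k₂' * (1 - 1 / (r : ℚ) ^ 2) :=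
      add_le_add
        (mul_sub_one_div_le (by exact_mod_cast hr₁) (by positivity) (by exact_mod_cast h₁))
        (mul_sub_one_div_le (by exact_mod_cast hr₂) (by positivity) (by exact_mod_cast h₂))
    _ = (r₁' * k₁' + r₂' * k₂' : ℚ) * (1 - 1 / (r : ℚ) ^ 2) := (add_mul _ _ _).symm
    _ ≤ r * k * (1 - 1 / (r : ℚ) ^ 2) := mul_le_mul_of_nonneg_right hΞ_cast hnonneg
    _ = _ := (mul_sub_one_div_eq (by exact_mod_cast hr) _).symm
end

section
/- Let r₁, r₂, k₁, k₂, r₁', r₂', k₁', k₂' be positive integers such that r₁' ≤ r₁, r₂' ≤ r₂, k₁ ≤ k₁', k₂ ≤ k₂', r₁'·k₁' + r₂'·k₂' ≤ r₁·k₁ + r₂·k₂, and at least one of r₁' < r₁ or r₂' < r₂ holds. Then, as rational numbers, k₁'·(r₁' − 1/r₁') + k₂'·(r₂' − 1/r₂') < k₁·(r₁ − 1/r₁) + k₂·(r₂ − 1/r₂). -/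
theorem stmt_4 (r₁ r₂ k₁ k₂ r₁' r₂' k₁' k₂' : ℕ)
    (hr₁ : 0 < r₁) (hr₂ : 0 < r₂) (hk₁ : 0 < k₁) (hk₂ : 0 < k₂)
    (hr₁' : 0 < r₁') (hr₂' : 0 < r₂') (hk₁' : 0 < k₁') (hk₂' : 0 < k₂')
    (h₁ : r₁' ≤ r₁) (h₂ : r₂' ≤ r₂)
    (h₃ : k₁ ≤ k₁') (h₄ : k₂ ≤ k₂')
    (hΞ : r₁' * k₁' + r₂' * k₂' ≤ r₁ * k₁ + r₂ * k₂)
    (hstrict : r₁' < r₁ ∨ r₂' < r₂) :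
    (k₁' : ℚ) * ((r₁' : ℚ) - 1 / (r₁' : ℚ)) + (k₂' : ℚ) * ((r₂' : ℚ) - 1 / (r₂' : ℚ))
      < (k₁ : ℚ) * ((r₁ : ℚ) - 1 / (r₁ : ℚ)) + (k₂ : ℚ) * ((r₂ : ℚ) - 1 / (r₂ : ℚ)) := by
  have hle {r r' k k' : ℕ} (hr' : 0 < r') (hkk : k ≤ k') (hrr : r' ≤ r) :
      (k : ℚ) / r ≤ (k' : ℚ) / r' := by
    gcongr
  have hlt {r r' k k' : ℕ} (hk : 0 < k) (hr' : 0 < r') (hkk : k ≤ k') (hrr : r' < r) :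
      (k : ℚ) / r < (k' : ℚ) / r' :=
    div_lt_div₀' (by exact_mod_cast hkk) (by exact_mod_cast hrr)
      (by exact_mod_cast hk.trans_le hkk) (by exact_mod_cast hr')
  have hΞ_rat : (r₁' : ℚ) * k₁' + r₂' * k₂' ≤ r₁ * k₁ + r₂ * k₂ := by exact_mod_cast hΞ
  have hsum : (k₁ : ℚ) / r₁ + k₂ / r₂ < k₁' / r₁' + k₂' / r₂' := by
    rcases hstrict with h | h
    · exact add_lt_add_of_lt_of_le (hlt hk₁ hr₁' h₃ h) (hle hr₂' h₄ h₂)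
    · exact add_lt_add_of_le_of_lt (hle hr₁' h₃ h₁) (hlt hk₂ hr₂' h₄ h)
  simp only [mul_sub, mul_one_div]
  linarith
end

section
/- Let r₁, r₂, k₁, k₂, r', k' be positive integers such that r' ≤ r₁, r' ≤ r₂, r₁ ≠ r₂, and r'·k' ≤ r₁·k₁ + r₂·k₂. Then, as rational numbers, k'·(r' − 1/r') < k₁·(r₁ − 1/r₁) + k₂·(r₂ − 1/r₂). -/
theorem mul_sub_one_div_eq_s7 {K : Type*} [Field K] {k r : K} (hr : r ≠ 0) :
    k * (r - 1 / r) = r * k * (1 - 1 / r ^ 2) := by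
  field_simp

theorem stmt_7 (r₁ r₂ k₁ k₂ r' k' : ℕ)
    (hr₁ : 0 < r₁) (hr₂ : 0 < r₂) (hk₁ : 0 < k₁) (hk₂ : 0 < k₂)
    (hr' : 0 < r') (hk' : 0 < k')
    (h₁ : r' ≤ r₁) (h₂ : r' ≤ r₂) (h₃ : r₁ ≠ r₂)
    (hΞ : r' * k' ≤ r₁ * k₁ + r₂ * k₂) :
    (k' : ℚ) * ((r' : ℚ) - 1 / (r' : ℚ))
      < (k₁ : ℚ) * ((r₁ : ℚ) - 1 / (r₁ : ℚ)) + (k₂ : ℚ) * ((r₂ : ℚ) - 1 / (r₂ : ℚ)) := by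
  have weight_le {r : ℕ} (h : r' ≤ r) : 1 - 1 / (r' : ℚ) ^ 2 ≤ 1 - 1 / (r : ℚ) ^ 2 := by
    gcongr
  have weight_lt {r : ℕ} (h : r' < r) : 1 - 1 / (r' : ℚ) ^ 2 < 1 - 1 / (r : ℚ) ^ 2 := by
    gcongr
  have weight_nonneg : 0 ≤ 1 - 1 / (r' : ℚ) ^ 2 := by
    exact sub_nonneg.2 (div_le_one_of_le₀
      (one_le_pow₀ (by exact_mod_cast hr' : (1 : ℚ) ≤ r')) (by positivity))
  have hΞ' : (r' : ℚ) * k' ≤ r₁ * k₁ + r₂ * k₂ := by exact_mod_cast hΞ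
  rw [mul_sub_one_div_eq_s7 (by positivity), mul_sub_one_div_eq_s7 (by positivity),
    mul_sub_one_div_eq_s7 (by positivity)]
  refine (mul_le_mul_of_nonneg_right hΞ' weight_nonneg).trans_lt ?_
  rw [add_mul]
  have hp₁ : (0 : ℚ) < r₁ * k₁ := by positivity
  have hp₂ : (0 : ℚ) < r₂ * k₂ := by positivity
  rcases h₁.lt_or_eq with h | rfl
  · exact add_lt_add_of_lt_of_le (mul_lt_mul_of_pos_left (weight_lt h) hp₁)
      (mul_le_mul_of_nonneg_left (weight_le h₂) hp₂.le)
  · exact add_lt_add_of_le_of_lt le_rfl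
      (mul_lt_mul_of_pos_left (weight_lt (lt_of_le_of_ne h₂ h₃)) hp₂)
end

section
/- Let r', k', m be positive integers such that m ≥ 3, m is odd, r' divides 2·m, and r'·k' ≤ m + 2. Then, as rational numbers, k'·(r' − 1/r') < m − 1/m + 3/2. -/
theorem stmt_13 (r' k' m : ℕ)
    (hr' : 0 < r') (hk' : 0 < k') (hm : 3 ≤ m) (hodd : Odd m)
    (hdvd : r' ∣ 2 * m) (h : r' * k' ≤ m + 2) :
    (k' : ℚ) * ((r' : ℚ) - 1 / (r' : ℚ)) < (m : ℚ) - 1 / (m : ℚ) + 3 / 2 := by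
  have hmQ : (3 : ℚ) ≤ m := by exact_mod_cast hm
  have hinv : 1 / (m : ℚ) ≤ 1 / 3 := one_div_le_one_div_of_le (by norm_num) hmQ
  rcases h.lt_or_eq with hlt | heq
  · have hle : (r' : ℚ) * k' ≤ m + 1 := by exact_mod_cast Nat.lt_succ_iff.mp hlt
    have hpos : 0 < (k' : ℚ) * (1 / r') := by positivity
    linarith
  · have hdvd' : r' ∣ m + 2 := ⟨k', heq.symm⟩
    have hdvd4 : r' ∣ 2 ^ 2 := by
      have h4 := Nat.dvd_sub (hdvd'.mul_left 2) hdvd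
      rwa [show 2 * (m + 2) - 2 * m = 2 ^ 2 by omega] at h4
    have hodd' : Odd r' := (hodd.add_even even_two).of_dvd_nat hdvd'
    have hone : r' = 1 := (hodd'.coprime_two_right.pow_right 2).eq_one_of_dvd hdvd4
    subst hone
    norm_num at hinv ⊢
    linarith
end
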